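/- arXiv:1712.05871 — 2 statements merged into one kernel-verified Lean document; each statement's English description precedes it below -/
import Mathlib

section
/- Error estimate for level-set approximation (uniformly continuous case): Suppose f : ℝ^n → ℝ is continuous, m ≥ 1, a_0 < a_1 < ⋯ < a_m, and the sublevel sets V_{a_i} = {x : f(x) ≤ a_i} are nonempty and compact for all i. Let Γ_{a_i} = {x : f(x) = a_i}, K = ∪_{i=0}^m Γ_{a_i}, and for 0 ≤ i ≤ m−1 let Ω_i = {x : a_i < f(x) < a_{i+1}} and, for x ∈ Ω_i, d_i(x) = inf over unit vectors ν of (d_ν^+(x) + d_ν^−(x)), where d_ν^+(x) = sup{t > 0 : x + sν ∈ Ω_i for all 0 ≤ s ≤ t} and d_ν^−(x) = sup{t > 0 : x − sν ∈ Ω_i for all 0 ≤ s ≤ t}. Let R > 0 be such that V_{a_m} ⊂ B(0,R), and let f̃ : ℝ^n → ℝ be a bounded uniformly continuous function with f̃ = f on V_{a_m}, f̃ = a_m + 1 on ℝ^n ∖ B(0,R), and |f̃| ≤ Ã_0 on ℝ^n. Let ω̃ : [0,∞) → [0,∞) be concave, nondecreasing, with ω̃(0) = 0, |f̃(x) − f̃(y)|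 ≤ ω̃(|x−y|) for all x, y, and ω̃(t) ≤ ã t + b̃ for all t ≥ 0, with constants ã ≥ 0, b̃ ≥ 0. If λ > a_m − a_0 + 1 and M > Ã_0 + λ(2R+1)², then for every i ∈ {0,…,m−1} and every x ∈ Ω_i, |A^M_λ(f_K)(x) − f(x)| ≤ ω̃( d_i(x) + ã/λ + √(2b̃/λ) ). -/
open Metric Set

variable {E : Type*}

/-- Convex envelope of `g`: the pointwise supremum of all affine functions lying below `g`. -/
noncomputable def convEnv [NormedAddCommGroup E] [NormedSpace ℝ E]
    (g : E → ℝ) (x : E) : ℝ :=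
  sSup {v : ℝ | ∃ l : E →ᵃ[ℝ] ℝ, (∀ y, l y ≤ g y) ∧ v = l x}

/-- Lower compensated convex transform `C^l_λ(f)`. -/
noncomputable def lowerTransform [NormedAddCommGroup E] [NormedSpace ℝ E]
    (lam : ℝ) (f : E → ℝ) (x : E) : ℝ :=
  convEnv (fun y => lam * ‖y‖ ^ 2 + f y) x - lam * ‖x‖ ^ 2

/-- Upper compensated convex transform `C^u_λ(f)`. -/
noncomputable def upperTransform [NormedAddCommGroup E] [NormedSpace ℝ E]
    (lam : ℝ) (f : E → ℝ) (x : E) : ℝ :=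
  lam * ‖x‖ ^ 2 - convEnv (fun y => lam * ‖y‖ ^ 2 - f y) x

open Classical in
/-- `extendBy f K M` is the function equal to `f` on `K` and to the constant `M` off `K`. -/
noncomputable def extendBy (f : E → ℝ) (K : Set E) (M : ℝ) (x : E) : ℝ :=
  if x ∈ K then f x else M

/-- Average compensated convex approximation `A^M_λ(f_K)`. -/
noncomputable def avgApprox [NormedAddCommGroup E] [NormedSpace ℝ E]
    (lam M : ℝ) (f : E → ℝ) (K : Set E) (x : E) : ℝ :=
  (lowerTransform lam (extendBy f K M) x + upperTransform lam (extendBy f K (-M)) x) / 2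

/-- `dPlus Q x ν`: supremum of `t > 0` such that the segment `x + [0,t]ν` stays in `Q`. -/
noncomputable def dPlus [NormedAddCommGroup E] [NormedSpace ℝ E]
    (Q : Set E) (x ν : E) : ℝ :=
  sSup {t : ℝ | 0 < t ∧ ∀ s : ℝ, 0 ≤ s → s ≤ t → x + s • ν ∈ Q}

/-- `dMinus Q x ν`: supremum of `t > 0` such that the segment `x - [0,t]ν` stays in `Q`. -/
noncomputable def dMinus [NormedAddCommGroup E] [NormedSpace ℝ E]
    (Q : Set E) (x ν : E) : ℝ :=
  sSup {t : ℝ | 0 < t ∧ ∀ s : ℝ, 0 ≤ s → s ≤ t → x - s • ν ∈ Q}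

/-- `gapWidth Q x = d(x)`: infimum over unit directions `ν` of `d_ν⁺(x) + d_ν⁻(x)`. -/
noncomputable def gapWidth [NormedAddCommGroup E] [NormedSpace ℝ E]
    (Q : Set E) (x : E) : ℝ :=
  sInf {d : ℝ | ∃ ν : E, ‖ν‖ = 1 ∧ d = dPlus Q x ν + dMinus Q x ν}

section ConvexHull

variable [NormedAddCommGroup E] [InnerProductSpace ℝ E]

/-- A function lying above a convex set of `E × ℝ` which is bounded below has affine minorants
coming arbitrarily close to the lower boundary of that set. -/
lemma exists_affineMap_le_of_convex [FiniteDimensional ℝ E] {C : Set (E × ℝ)} (hC : Convex ℝ C)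
    {g : E → ℝ} (hg : ∀ y, (y, g y) ∈ C) {b : ℝ} (hb : ∀ p ∈ C, b ≤ p.2) {x : E} {c : ℝ}
    (hc : ∀ t, (x, t) ∈ C → c ≤ t) {c' : ℝ} (hc' : c' < c) :
    ∃ l : E →ᵃ[ℝ] ℝ, (∀ y, l y ≤ g y) ∧ l x = c' := by
  let G : E → ℝ := fun y => sInf {t | (y, t) ∈ C}
  have hne : ∀ y, {t | (y, t) ∈ C}.Nonempty := fun y => ⟨g y, hg y⟩
  have hbdd : ∀ y, BddBelow {t | (y, t) ∈ C} := fun y => ⟨b, fun t ht => hb _ ht⟩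
  have hGg : ∀ y, G y ≤ g y := fun y => csInf_le (hbdd y) (hg y)
  have hGconv : ConvexOn ℝ univ G := by
    refine ⟨convex_univ, fun y _ z _ α β hα hβ hαβ => ?_⟩
    refine le_of_forall_pos_le_add fun ε hε => ?_
    obtain ⟨s, hs, hs'⟩ := exists_lt_of_csInf_lt (hne y) (lt_add_of_pos_right (G y) hε)
    obtain ⟨t, ht, ht'⟩ := exists_lt_of_csInf_lt (hne z) (lt_add_of_pos_right (G z) hε)
    have hmem : (α • y + β • z, α • s + β • t) ∈ C := hC hs ht hα hβ hαβ
    have h1 : G (α • y + β • z) ≤ α • s + β • t := csInf_le (hbdd _) hmem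
    have h2 := mul_le_mul_of_nonneg_left hs'.le hα
    have h3 := mul_le_mul_of_nonneg_left ht'.le hβ
    simp only [smul_eq_mul] at h1 ⊢
    have h4 : α * ε + β * ε = ε := by rw [← add_mul, hαβ, one_mul]
    linarith
  have hGcont : ContinuousOn G univ := hGconv.continuousOn isOpen_univ
  have hGx : c' < G x := hc'.trans_le (le_csInf (hne x) fun t ht => hc t ht)
  obtain ⟨l, d, hl, hlx⟩ := hGconv.exists_affine_le_of_lt (𝕜 := ℝ) (mem_univ x) hGx isClosed_univ
    hGcont.lowerSemicontinuousOn
  refine ⟨l.toLinearMap.toAffineMap + AffineMap.const ℝ E d, fun y => ?_, ?_⟩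
  · have h1 := hl ⟨y, mem_univ y⟩
    simp at h1
    simpa using h1.trans (hGg y)
  · simpa using hlx

/-- The points `(y, ‖y - x‖² + p y, h y)` for `y ∈ S`. -/
def liftedGraph (h p : E → ℝ) (x : E) (S : Set E) : Set (E × ℝ × ℝ) :=
  (fun y => (y, ‖y - x‖ ^ 2 + p y, h y)) '' S

/-- The affine function whose difference with `lam * ‖y‖ ^ 2` is `lam * ‖y - x‖ ^ 2`. -/
noncomputable def sqNormGap (lam : ℝ) (x : E) : E →ᵃ[ℝ] ℝ :=
  ((2 * lam) • (innerSL ℝ x).toLinearMap).toAffineMap + AffineMap.const ℝ E (-(lam * ‖x‖ ^ 2))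

lemma sqNormGap_apply (lam : ℝ) (x y : E) :
    sqNormGap lam x y = lam * ‖y‖ ^ 2 - lam * ‖y - x‖ ^ 2 := by
  rw [norm_sub_sq_real, real_inner_comm]
  simp [sqNormGap]
  ring

lemma sqNormGap_self (lam : ℝ) (x : E) : sqNormGap lam x x = lam * ‖x‖ ^ 2 := by
  simp [sqNormGap_apply]

lemma lowerTransform_le_of_mem {lam : ℝ} (hlam : 0 ≤ lam) {k h : E → ℝ} {K : Set E}
    {b : ℝ} (hb : ∀ y, b ≤ k y) (hk : ∀ y ∈ K, k y = h y) {x : E} {q η : ℝ}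
    (hq : (x, q, η) ∈ convexHull ℝ (liftedGraph h 0 x K)) :
    lowerTransform lam k x ≤ lam * q + η := by
  rw [lowerTransform, sub_le_iff_le_add]
  refine csSup_le ⟨b, AffineMap.const ℝ E b, fun y => ?_, by simp⟩ ?_
  · have := hb y
    have : 0 ≤ lam * ‖y‖ ^ 2 := by positivity
    simp only [AffineMap.const_apply]
    linarith
  · rintro v ⟨l, hl, rfl⟩
    have hsub : convexHull ℝ (liftedGraph h 0 x K) ⊆
        {p : E × ℝ × ℝ | l p.1 ≤ lam * p.2.1 + p.2.2 + sqNormGap lam x p.1} := by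
      refine convexHull_min ?_ ?_
      · rintro _ ⟨y, hy, rfl⟩
        have := hl y
        simp only [mem_ofPred_eq, sqNormGap_apply, ← hk y hy, Pi.zero_apply]
        linarith
      · rintro ⟨y, s, t⟩ hy ⟨z, u, v⟩ hz α β hα hβ hαβ
        simp only [mem_ofPred_eq, Prod.fst_add, Prod.snd_add, Prod.smul_fst, Prod.smul_snd,
          smul_eq_mul, Convex.combo_affine_apply hαβ] at hy hz ⊢
        nlinarith [mul_le_mul_of_nonneg_left hy hα, mul_le_mul_of_nonneg_left hz hβ]
    have := hsub hq
    simp only [mem_ofPred_eq, sqNormGap_self] at this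
    linarith

lemma le_of_mem_convexHull {lam : ℝ} (hlam : 0 ≤ lam) {h p : E → ℝ} {b : ℝ} (hb : ∀ y, b ≤ h y)
    (hp : ∀ y, 0 ≤ p y) {x : E} {S : Set E} {w : E × ℝ × ℝ}
    (hw : w ∈ convexHull ℝ (liftedGraph h p x S)) : b ≤ lam * w.2.1 + w.2.2 := by
  revert w
  change convexHull ℝ (liftedGraph h p x S) ⊆ {w | b ≤ lam * w.2.1 + w.2.2}
  refine convexHull_min ?_ ?_
  · rintro _ ⟨y, -, rfl⟩
    have h1 := hb y
    have h2 := hp y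
    have : 0 ≤ lam * (‖y - x‖ ^ 2 + p y) := by positivity
    simp only [mem_ofPred_eq]
    linarith
  · rintro ⟨y, s, t⟩ hy ⟨z, u, v⟩ hz α β hα hβ hαβ
    simp only [mem_ofPred_eq, Prod.snd_add, Prod.smul_fst, Prod.smul_snd, Prod.fst_add,
      smul_eq_mul] at hy hz ⊢
    have : α * b + β * b = b := by rw [← add_mul, hαβ, one_mul]
    nlinarith [mul_le_mul_of_nonneg_left hy hα, mul_le_mul_of_nonneg_left hz hβ]

lemma le_lowerTransform_of_forall_mem [FiniteDimensional ℝ E] {lam : ℝ} (hlam : 0 ≤ lam)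
    {k h p : E → ℝ} {b : ℝ} (hb : ∀ y, b ≤ h y) (hp : ∀ y, 0 ≤ p y)
    (hk : ∀ y, h y + lam * p y ≤ k y) {x : E} {c : ℝ}
    (hc : ∀ q η, (x, q, η) ∈ convexHull ℝ (liftedGraph h p x univ) → c ≤ lam * q + η) :
    c ≤ lowerTransform lam k x := by
  let C : Set (E × ℝ) :=
    {w | ∃ q η, (w.1, q, η) ∈ convexHull ℝ (liftedGraph h p x univ) ∧ lam * q + η = w.2}
  have hC : Convex ℝ C := by
    rintro ⟨y, s⟩ ⟨q, η, hy, hs⟩ ⟨z, t⟩ ⟨q', η', hz, ht⟩ α β hα hβ hαβ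
    refine ⟨α • q + β • q', α • η + β • η', (convex_convexHull ℝ _) hy hz hα hβ hαβ, ?_⟩
    simp only at hs ht
    simp only [Prod.snd_add, Prod.smul_snd, smul_eq_mul, ← hs, ← ht]
    ring
  rw [lowerTransform, le_sub_iff_add_le]
  refine le_of_forall_lt_imp_le_of_dense fun d hd => ?_
  obtain ⟨l, hl, hlx⟩ := exists_affineMap_le_of_convex hC
    (g := fun y => lam * (‖y - x‖ ^ 2 + p y) + h y)
    (fun y => ⟨_, _, subset_convexHull ℝ _ ⟨y, mem_univ y, rfl⟩, rfl⟩)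
    (b := b) (by rintro ⟨y, t⟩ ⟨q, η, hy, rfl⟩; exact le_of_mem_convexHull hlam hb hp hy)
    (x := x) (c := c)
    (by rintro t ⟨q, η, hy, rfl⟩; exact hc q η hy) (c' := d - lam * ‖x‖ ^ 2) (by linarith)
  refine le_csSup ⟨lam * ‖x‖ ^ 2 + k x, ?_⟩ ⟨l + sqNormGap lam x, fun y => ?_, ?_⟩
  · rintro _ ⟨l, hl, rfl⟩
    exact hl x
  · have h1 := hl y
    have h2 := hk y
    simp only [AffineMap.coe_add, Pi.add_apply, sqNormGap_apply]
    linarith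
  · simp [hlx, sqNormGap_self]

lemma abs_sub_le_of_mem_convexHull {h p : E → ℝ} {x : E} {S : Set E} {ω : ℝ → ℝ}
    (hω : ConcaveOn ℝ (Ici 0) ω) (hmono : MonotoneOn ω (Ici 0))
    (hmod : ∀ y, |h y - h x| ≤ ω ‖y - x‖) (hp : ∀ y ∈ S, 0 ≤ p y) {w : E × ℝ × ℝ}
    (hw : w ∈ convexHull ℝ (liftedGraph h p x S)) :
    0 ≤ w.2.1 ∧ |w.2.2 - h x| ≤ ω (√w.2.1) := by
  have hsub : convexHull ℝ (liftedGraph h p x S) ⊆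
      {w | ∃ s : ℝ, 0 ≤ s ∧ s ^ 2 ≤ w.2.1 ∧ |w.2.2 - h x| ≤ ω s} := by
    refine convexHull_min ?_ ?_
    · rintro _ ⟨y, hy, rfl⟩
      exact ⟨‖y - x‖, norm_nonneg _, by simpa using hp y hy, hmod y⟩
    · rintro ⟨y, u, v⟩ ⟨s, hs, hsu, hsv⟩ ⟨z, u', v'⟩ ⟨t, ht, htu, htv⟩ α β hα hβ hαβ
      simp only at hsu hsv htu htv
      refine ⟨α * s + β * t, by positivity, ?_, ?_⟩
      · simp only [Prod.snd_add, Prod.smul_snd, Prod.smul_fst, Prod.fst_add, smul_eq_mul]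
        have h1 := (convexOn_pow 2).2 (mem_Ici.2 hs) (mem_Ici.2 ht) hα hβ hαβ
        simp only [smul_eq_mul] at h1
        nlinarith [mul_le_mul_of_nonneg_left hsu hα, mul_le_mul_of_nonneg_left htu hβ]
      · simp only [Prod.snd_add, Prod.smul_snd, smul_eq_mul]
        have h1 := hω.2 (mem_Ici.2 hs) (mem_Ici.2 ht) hα hβ hαβ
        simp only [smul_eq_mul] at h1
        have h2 : α * v + β * v' - h x = α * (v - h x) + β * (v' - h x) := by
          linear_combination h x * hαβ
        rw [h2]
        refine (abs_add_le _ _).trans (le_trans ?_ h1)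
        rw [abs_mul, abs_mul, abs_of_nonneg hα, abs_of_nonneg hβ]
        gcongr
  obtain ⟨s, hs, hsq, hle⟩ := hsub hw
  exact ⟨(sq_nonneg s).trans hsq,
    hle.trans (hmono hs (Real.sqrt_nonneg _) (Real.le_sqrt_of_sq_le hsq))⟩

/-- Every point of the convex hull of a lifted graph over the whole space is, up to a dilation of
factor at least one centred at `x`, represented by the part of the graph over `K`. -/
lemma exists_dilation_of_mem_convexHull {h p : E → ℝ} {x : E} {K : Set E}
    (hrep : ∀ y, ∃ c : ℝ, 1 ≤ c ∧ ∃ z q η, (z, q, η) ∈ convexHull ℝ (liftedGraph h 0 x K) ∧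
      y - x = c • (z - x) ∧ c * q ≤ ‖y - x‖ ^ 2 + p y) {w : E × ℝ × ℝ}
    (hw : w ∈ convexHull ℝ (liftedGraph h p x univ)) :
    ∃ c : ℝ, 1 ≤ c ∧ ∃ z q η, (z, q, η) ∈ convexHull ℝ (liftedGraph h 0 x K) ∧
      w.1 - x = c • (z - x) ∧ c * q ≤ w.2.1 := by
  revert w
  change convexHull ℝ (liftedGraph h p x univ) ⊆ {w | ∃ c : ℝ, 1 ≤ c ∧ ∃ z q η,
    (z, q, η) ∈ convexHull ℝ (liftedGraph h 0 x K) ∧ w.1 - x = c • (z - x) ∧ c * q ≤ w.2.1}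
  refine convexHull_min ?_ ?_
  · rintro _ ⟨y, -, rfl⟩
    exact hrep y
  · rintro ⟨y, u, v⟩ ⟨c, hc, z, q, η, hz, hyz, hq⟩ ⟨y', u', v'⟩ ⟨c', hc', z', q', η', hz', hyz', hq'⟩
      α β hα hβ hαβ
    simp only at hyz hyz' hq hq'
    have hW : 1 ≤ α * c + β * c' := by nlinarith
    have hW0 : 0 < α * c + β * c' := by linarith
    refine ⟨α * c + β * c', hW, _, _, _, (convex_convexHull ℝ _) hz hz'
      (a := α * c / (α * c + β * c')) (b := β * c' / (α * c + β * c'))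
      (by positivity) (by positivity) (by field_simp), ?_, ?_⟩
    · have h1 : α • y + β • y' - x = α • (y - x) + β • (y' - x) := by
        have : x = α • x + β • x := by rw [← add_smul, hαβ, one_smul]
        nth_rewrite 1 [this]
        module
      simp only [Prod.fst_add, Prod.smul_fst]
      simp only [h1, hyz, hyz', smul_sub (α * c + β * c'), smul_add, smul_smul,
        mul_div_cancel₀ _ hW0.ne']
      module
    · simp only [Prod.snd_add, Prod.smul_snd, Prod.smul_fst, Prod.fst_add, smul_eq_mul]
      have : (α * c + β * c') * (α * c / (α * c + β * c') * q + β * c' / (α * c + β * c') * q') =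
          α * (c * q) + β * (c' * q') := by
        field_simp
      rw [this]
      gcongr

open Classical in
lemma exists_lowerTransform_sub_ge [FiniteDimensional ℝ E] {lam : ℝ} (hlam : 0 ≤ lam)
    {h : E → ℝ} {K : Set E} {x : E} {A M P : ℝ} (hA : ∀ y, |h y| ≤ A) (hP : 0 ≤ P)
    (hM : A + lam * P ≤ M) {ω : ℝ → ℝ}
    (hω : ConcaveOn ℝ (Ici 0) ω) (hmono : MonotoneOn ω (Ici 0))
    (hmod : ∀ y, |h y - h x| ≤ ω ‖y - x‖)
    (hrep : ∀ y, ∃ c : ℝ, 1 ≤ c ∧ ∃ z q η, (z, q, η) ∈ convexHull ℝ (liftedGraph h 0 x K) ∧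
      y - x = c • (z - x) ∧ c * q ≤ ‖y - x‖ ^ 2 + if y ∈ K then 0 else P)
    {q₀ η₀ : ℝ} (h₀ : (x, q₀, η₀) ∈ convexHull ℝ (liftedGraph h 0 x K)) {ε : ℝ} (hε : 0 < ε) :
    ∃ q : ℝ, 0 ≤ q ∧ lam * q ≤ lam * q₀ + ω (√q) + ω (√q₀) + ε ∧
      2 * h x - 2 * ω (√q) - ε ≤ lowerTransform lam (extendBy h K M) x -
        lowerTransform lam (extendBy (-h) K M) x := by
  set p : E → ℝ := fun y => if y ∈ K then 0 else P
  have hp : ∀ y, 0 ≤ p y := fun y => by simp only [p]; split_ifs <;> simp [hP]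
  have hA0 : 0 ≤ A := (abs_nonneg _).trans (hA x)
  have hlP : 0 ≤ lam * P := mul_nonneg hlam hP
  have hsub : liftedGraph h 0 x K ⊆ liftedGraph h p x univ := by
    rintro _ ⟨y, hy, rfl⟩
    exact ⟨y, mem_univ y, by simp [p, hy]⟩
  obtain ⟨q, η, hmem, hlow, hup⟩ : ∃ q η, (x, q, η) ∈ convexHull ℝ (liftedGraph h p x univ) ∧
      lam * q + η ≤ lam * q₀ + η₀ + ε ∧
      lam * q + η - ε ≤ lowerTransform lam (extendBy h K M) x := by
    let V : Set ℝ := {v | ∃ q η, (x, q, η) ∈ convexHull ℝ (liftedGraph h p x univ) ∧ lam * q + η = v}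
    have hbelow : ∀ y, -A ≤ h y := fun y => neg_le_of_abs_le (hA y)
    have hV₀ : lam * q₀ + η₀ ∈ V := ⟨q₀, η₀, convexHull_mono hsub h₀, rfl⟩
    have hVbdd : BddBelow V := by
      refine ⟨-A, ?_⟩
      rintro _ ⟨q, η, hmem, rfl⟩
      exact le_of_mem_convexHull hlam hbelow hp hmem
    obtain ⟨_, ⟨q, η, hmem, rfl⟩, hlt⟩ :=
      exists_lt_of_csInf_lt ⟨_, hV₀⟩ (lt_add_of_pos_right (sInf V) hε)
    refine ⟨q, η, hmem, by linarith [csInf_le hVbdd hV₀], ?_⟩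
    have : sInf V ≤ lowerTransform lam (extendBy h K M) x := by
      refine le_lowerTransform_of_forall_mem hlam hbelow hp (fun y => ?_)
        (fun q η hq => csInf_le hVbdd ⟨q, η, hq, rfl⟩)
      by_cases hy : y ∈ K
      · simp [extendBy, p, hy]
      · simp only [extendBy, p, hy, if_false]
        linarith [le_of_abs_le (hA y)]
    linarith
  obtain ⟨c, hc, z, q', η', hz, hxz, hq'⟩ := exists_dilation_of_mem_convexHull hrep hmem
  obtain rfl : z = x := by
    rw [sub_self, eq_comm, smul_eq_zero] at hxz
    rcases hxz with rfl | hxz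
    · linarith
    · exact sub_eq_zero.1 hxz
  obtain ⟨hq0, hη⟩ := abs_sub_le_of_mem_convexHull hω hmono hmod (fun y _ => hp y) hmem
  obtain ⟨hq0', hη'⟩ := abs_sub_le_of_mem_convexHull hω hmono hmod (fun y _ => le_rfl) hz
  obtain ⟨-, hη₀⟩ := abs_sub_le_of_mem_convexHull hω hmono hmod (fun y _ => le_rfl) h₀
  simp only at hq0 hη hq0' hη' hη₀ hq'
  have hqq : q' ≤ q := by nlinarith
  have hωqq : ω (√q') ≤ ω (√q) :=
    hmono (Real.sqrt_nonneg _) (Real.sqrt_nonneg _) (Real.sqrt_le_sqrt hqq)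
  have hneg : (z, q', -η') ∈ convexHull ℝ (liftedGraph (-h) 0 z K) := by
    let F : E × ℝ × ℝ →ₗ[ℝ] E × ℝ × ℝ :=
      LinearMap.prodMap LinearMap.id (LinearMap.prodMap LinearMap.id (-LinearMap.id))
    have hF : F '' liftedGraph h 0 z K = liftedGraph (-h) 0 z K := by
      simp [liftedGraph, image_image, F]
    rw [← hF, ← F.image_convexHull]
    exact ⟨_, hz, by simp [F]⟩
  have hupper : lowerTransform lam (extendBy (-h) K M) z ≤ lam * q' + -η' := by
    refine lowerTransform_le_of_mem hlam (b := -A) (fun y => ?_) (fun y hy => ?_) hneg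
    · by_cases hy : y ∈ K
      · simpa [extendBy, hy] using le_of_abs_le (hA y)
      · simp only [extendBy, hy, if_false]
        linarith
    · simp [extendBy, hy]
  have hlq : lam * q' ≤ lam * q := by gcongr
  rw [abs_le] at hη hη' hη₀
  exact ⟨q, hq0, by linarith, by linarith⟩

end ConvexHull

lemma upperTransform_eq_neg_lowerTransform [NormedAddCommGroup E] [NormedSpace ℝ E] (lam : ℝ)
    (k : E → ℝ) (x : E) : upperTransform lam k x = -lowerTransform lam (-k) x := by
  simp [upperTransform, lowerTransform, sub_eq_add_neg]

lemma neg_extendBy (h : E → ℝ) (K : Set E) (M : ℝ) :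
    -extendBy h K (-M) = extendBy (-h) K M := by
  ext y
  by_cases hy : y ∈ K <;> simp [extendBy, hy]

lemma avgApprox_eq [NormedAddCommGroup E] [NormedSpace ℝ E] (lam M : ℝ) (h : E → ℝ) (K : Set E)
    (x : E) : avgApprox lam M h K x =
      (lowerTransform lam (extendBy h K M) x - lowerTransform lam (extendBy (-h) K M) x) / 2 := by
  rw [avgApprox, upperTransform_eq_neg_lowerTransform, neg_extendBy, sub_eq_add_neg]

section Rays

variable [NormedAddCommGroup E] [NormedSpace ℝ E]

lemma dMinus_eq_dPlus_neg (Q : Set E) (x ν : E) : dMinus Q x ν = dPlus Q x (-ν) := by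
  simp [dMinus, dPlus, sub_eq_add_neg]

lemma le_two_mul_of_add_smul_mem_ball {R t : ℝ} {x ν : E} (hν : ‖ν‖ = 1) (hx : x ∈ ball 0 R)
    (ht : x + t • ν ∈ ball 0 R) : t ≤ 2 * R := by
  have h1 : ‖t • ν‖ ≤ ‖x + t • ν‖ + ‖x‖ := by
    simpa using norm_sub_le (x + t • ν) x
  rw [norm_smul, hν, mul_one] at h1
  rw [mem_ball_zero_iff] at hx ht
  linarith [Real.le_norm_self t]

lemma bddAbove_dPlus {Q : Set E} {R : ℝ} (hQ : Q ⊆ ball 0 R) {x ν : E} (hx : x ∈ Q)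
    (hν : ‖ν‖ = 1) :
    BddAbove {t : ℝ | 0 < t ∧ ∀ s : ℝ, 0 ≤ s → s ≤ t → x + s • ν ∈ Q} :=
  ⟨2 * R, fun t ht =>
    le_two_mul_of_add_smul_mem_ball hν (hQ hx) (hQ (ht.2 t ht.1.le le_rfl))⟩

lemma le_dPlus {Q : Set E} {R r : ℝ} (hQ : Q ⊆ ball 0 R) {x ν : E} (hν : ‖ν‖ = 1) (hr : 0 < r)
    (hball : closedBall x r ⊆ Q) : r ≤ dPlus Q x ν := by
  refine le_csSup (bddAbove_dPlus hQ (hball (mem_closedBall_self hr.le)) hν)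
    ⟨hr, fun s hs hsr => hball ?_⟩
  simpa [norm_smul, hν, abs_of_nonneg hs] using hsr

lemma eq_or_eq_of_dPlus {f : E → ℝ} (hf : Continuous f) {α β R : ℝ}
    (hQ : {y | α < f y ∧ f y < β} ⊆ ball 0 R) {x ν : E} (hx : α < f x ∧ f x < β) (hν : ‖ν‖ = 1)
    (hpos : 0 < dPlus {y | α < f y ∧ f y < β} x ν) :
    f (x + dPlus {y | α < f y ∧ f y < β} x ν • ν) = α ∨
      f (x + dPlus {y | α < f y ∧ f y < β} x ν • ν) = β := by
  set Q : Set E := {y | α < f y ∧ f y < β}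
  set T := dPlus Q x ν
  have hbdd := bddAbove_dPlus hQ (show x ∈ Q from hx) hν
  have hne : {t : ℝ | 0 < t ∧ ∀ s : ℝ, 0 ≤ s → s ≤ t → x + s • ν ∈ Q}.Nonempty := by
    by_contra hemp
    rw [not_nonempty_iff_eq_empty] at hemp
    have : T = 0 := by simp only [T, dPlus, hemp, Real.sSup_empty]
    exact hpos.ne' this
  have hφ : Continuous fun s : ℝ => f (x + s • ν) := by fun_prop
  have hlt : ∀ s, 0 ≤ s → s < T → x + s • ν ∈ Q := fun s hs hsT => by
    obtain ⟨t, ht, hst⟩ := exists_lt_of_lt_csSup hne hsT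
    exact ht.2 s hs hst.le
  have hT : f (x + T • ν) ∈ Icc α β := by
    have hsub : Ico 0 T ⊆ (fun s : ℝ => f (x + s • ν)) ⁻¹' Icc α β := fun s hs =>
      ⟨(hlt s hs.1 hs.2).1.le, (hlt s hs.1 hs.2).2.le⟩
    have := closure_minimal hsub (isClosed_Icc.preimage hφ)
    rw [closure_Ico hpos.ne] at this
    exact this (right_mem_Icc.2 hpos.le)
  by_contra! hcon
  have hopen : IsOpen ((fun s : ℝ => f (x + s • ν)) ⁻¹' Ioo α β) := isOpen_Ioo.preimage hφ
  obtain ⟨δ, hδ, hball⟩ := Metric.isOpen_iff.1 hopen T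
    ⟨lt_of_le_of_ne hT.1 hcon.1.symm, lt_of_le_of_ne hT.2 hcon.2⟩
  have hmem : T + δ / 2 ≤ T := le_csSup hbdd ⟨by linarith, fun s hs hsT => by
    rcases lt_or_ge s T with h | h
    · exact hlt s hs h
    · refine hball ?_
      rw [mem_ball, Real.dist_eq, abs_of_nonneg (by linarith)]
      linarith⟩
  linarith

lemma exists_eq_on_ray {f : E → ℝ} (hf : Continuous f) {b R : ℝ} (hV : {y | f y ≤ b} ⊆ ball 0 R)
    {y ν : E} (hy : f y ≤ b) (hν : ‖ν‖ = 1) : ∃ t ∈ Icc 0 (2 * R), f (y + t • ν) = b := by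
  have hR : 0 ≤ R := by
    have := mem_ball_zero_iff.1 (hV hy)
    linarith [norm_nonneg y]
  have hend : b ≤ f (y + (2 * R) • ν) := by
    by_contra! hlt
    have h1 := mem_ball_zero_iff.1 (hV hlt.le)
    have h2 := mem_ball_zero_iff.1 (hV hy)
    have h3 : ‖(2 * R) • ν‖ ≤ ‖y + (2 * R) • ν‖ + ‖y‖ := by
      simpa using norm_sub_le (y + (2 * R) • ν) y
    rw [norm_smul, hν, mul_one, Real.norm_of_nonneg (by linarith)] at h3
    linarith
  have hφ : ContinuousOn (fun s : ℝ => f (y + s • ν)) (Icc 0 (2 * R)) := by fun_prop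
  obtain ⟨t, ht, hft⟩ := intermediate_value_Icc (by linarith) hφ ⟨by simpa using hy, hend⟩
  exact ⟨t, ht, hft⟩

end Rays

lemma mem_convexHull_liftedGraph_of_segment [NormedAddCommGroup E] [InnerProductSpace ℝ E]
    {h : E → ℝ} {K : Set E} {x y ν : E} (hν : ‖ν‖ = 1) {s t : ℝ} (hs : 0 ≤ s) (ht : 0 ≤ t)
    (hst : 0 < s + t) (hsK : y + s • ν ∈ K) (htK : y + t • (-ν) ∈ K) :
    ∃ η, (y, ‖y - x‖ ^ 2 + s * t, η) ∈ convexHull ℝ (liftedGraph h 0 x K) := by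
  have hmem := (convex_convexHull ℝ (liftedGraph h 0 x K))
    (subset_convexHull ℝ _ ⟨_, hsK, rfl⟩) (subset_convexHull ℝ _ ⟨_, htK, rfl⟩)
    (a := t / (s + t)) (b := s / (s + t)) (by positivity) (by positivity) (by field_simp; ring)
  refine ⟨t / (s + t) * h (y + s • ν) + s / (s + t) * h (y + t • (-ν)), ?_⟩
  convert hmem using 1
  refine Prod.ext ?_ (Prod.ext ?_ rfl)
  · have h1 : t / (s + t) + s / (s + t) = 1 := by field_simp; ring
    have h2 : t / (s + t) * s - s / (s + t) * t = 0 := by ring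
    simp only [Prod.fst_add, Prod.smul_fst]
    calc y = (t / (s + t) + s / (s + t)) • y + (t / (s + t) * s - s / (s + t) * t) • ν := by
          rw [h1, h2]; simp
      _ = _ := by module
  · have hs' : ‖y + s • ν - x‖ ^ 2 = ‖y - x‖ ^ 2 + 2 * s * inner ℝ (y - x) ν + s ^ 2 := by
      rw [show y + s • ν - x = (y - x) + s • ν by abel, norm_add_sq_real, inner_smul_right,
        norm_smul, hν, mul_one, Real.norm_eq_abs, sq_abs]
      ring
    have ht' : ‖y + t • (-ν) - x‖ ^ 2 = ‖y - x‖ ^ 2 - 2 * t * inner ℝ (y - x) ν + t ^ 2 := by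
      rw [show y + t • (-ν) - x = (y - x) - t • ν by rw [smul_neg]; abel, norm_sub_sq_real,
        inner_smul_right, norm_smul, hν, mul_one, Real.norm_eq_abs, sq_abs]
      ring
    simp only [Prod.fst_add, Prod.snd_add, Prod.smul_fst, Prod.smul_snd, smul_eq_mul,
      Pi.zero_apply, add_zero, hs', ht']
    field_simp
    ring

open Classical in
lemma exists_dilation_mem_convexHull_liftedGraph [NormedAddCommGroup E] [InnerProductSpace ℝ E]
    {f : E → ℝ} (hf : Continuous f) {b R : ℝ} (hV : {y | f y ≤ b} ⊆ ball 0 R) {K : Set E}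
    (hK : {y | f y = b} ⊆ K) {x ν : E} (hx : f x < b) (hν : ‖ν‖ = 1) (h : E → ℝ) (y : E) :
    ∃ c : ℝ, 1 ≤ c ∧ ∃ z q η, (z, q, η) ∈ convexHull ℝ (liftedGraph h 0 x K) ∧
      y - x = c • (z - x) ∧ c * q ≤ ‖y - x‖ ^ 2 + if y ∈ K then 0 else (2 * R) ^ 2 := by
  by_cases hyK : y ∈ K
  · exact ⟨1, le_rfl, y, _, _, subset_convexHull ℝ _ ⟨y, hyK, rfl⟩, by simp, by simp [hyK]⟩
  rcases le_or_gt (f y) b with hy | hy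
  · obtain ⟨s, ⟨hs0, hsR⟩, hs⟩ := exists_eq_on_ray hf hV hy hν
    obtain ⟨t, ⟨ht0, htR⟩, ht⟩ := exists_eq_on_ray hf hV hy (ν := -ν) (by rwa [norm_neg])
    have hst : 0 < s + t := by
      refine lt_of_le_of_ne (by positivity) fun h0 => hyK (hK ?_)
      obtain rfl : s = 0 := by linarith
      simpa using hs
    obtain ⟨η, hη⟩ := mem_convexHull_liftedGraph_of_segment (h := h) (x := x) hν hs0 ht0 hst
      (hK hs) (hK ht)
    refine ⟨1, le_rfl, y, _, η, hη, by simp, ?_⟩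
    simp only [hyK, if_false, one_mul]
    nlinarith
  · have hφ : ContinuousOn (fun s : ℝ => f (x + s • (y - x))) (Icc 0 1) := by fun_prop
    obtain ⟨t, ⟨ht0, ht1⟩, ht⟩ := intermediate_value_Icc zero_le_one hφ
      ⟨by simpa using hx.le, by simpa using hy.le⟩
    simp only at ht
    have htpos : 0 < t := by
      refine lt_of_le_of_ne ht0 ?_
      rintro rfl
      simp at ht
      exact hx.ne ht
    refine ⟨t⁻¹, (one_le_inv₀ htpos).2 ht1, _, _, _, subset_convexHull ℝ _ ⟨_, hK ht, rfl⟩, ?_, ?_⟩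
    · simp [smul_smul, inv_mul_cancel₀ htpos.ne']
    · have h1 : t⁻¹ * (t ^ 2 * ‖y - x‖ ^ 2) = t * ‖y - x‖ ^ 2 := by field_simp
      simp only [add_sub_cancel_left, norm_smul, Real.norm_of_nonneg ht0, mul_pow, Pi.zero_apply,
        add_zero, hyK, if_false, h1]
      nlinarith [sq_nonneg ‖y - x‖, sq_nonneg R]

/-- A quadratic inequality with affine perturbation bounds its solutions. -/
lemma le_add_div_add_sqrt {lam a b D r r₀ : ℝ} (hlam : 0 < lam) (ha : 0 ≤ a) (hb : 0 ≤ b)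
    (hD : 0 < D)
    (h : lam * r ^ 2 ≤ lam * r₀ ^ 2 + (a * r + b) + (a * r₀ + b) + lam * (D ^ 2 - r₀ ^ 2))
    (hr₀ : r₀ ≤ D) : r ≤ D + a / lam + √(2 * b / lam) := by
  set σ := √(2 * b / lam)
  have hσ : lam * σ ^ 2 = 2 * b := by
    rw [Real.sq_sqrt (by positivity)]
    field_simp
  have hσ0 : 0 ≤ σ := Real.sqrt_nonneg _
  by_contra! hlt
  set τ := a / lam
  have hτ : lam * τ = a := mul_div_cancel₀ _ hlam.ne'
  have hτ0 : 0 ≤ τ := by positivity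
  have h1 : (D + τ + σ) * (D + σ) < r * (r - τ) := by
    apply mul_lt_mul'' hlt <;> linarith
  have h2 := mul_lt_mul_of_pos_left h1 hlam
  have h3 : a * r₀ ≤ a * D := mul_le_mul_of_nonneg_left hr₀ ha
  have h4 : 0 ≤ lam * (2 * D * σ + τ * σ) := by positivity
  have h5 : lam * (r * (r - τ)) = lam * r ^ 2 - a * r := by rw [← hτ]; ring
  have h6 : lam * ((D + τ + σ) * (D + σ)) =
      lam * D ^ 2 + a * D + 2 * b + lam * (2 * D * σ + τ * σ) := by rw [← hτ, ← hσ]; ring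
  linarith

/-- **Error estimate for level-set approximation (uniformly continuous case).** -/
theorem level_set_error_estimate_uc {n : ℕ} (f : EuclideanSpace ℝ (Fin n) → ℝ)
    (hf : Continuous f) (m : ℕ) (hm : 1 ≤ m) (a : Fin (m + 1) → ℝ) (ha : StrictMono a)
    (hVne : ∀ i : Fin (m + 1), {x : EuclideanSpace ℝ (Fin n) | f x ≤ a i}.Nonempty)
    (hVcpt : ∀ i : Fin (m + 1), IsCompact {x : EuclideanSpace ℝ (Fin n) | f x ≤ a i})
    (K : Set (EuclideanSpace ℝ (Fin n)))
    (hK : K = ⋃ i : Fin (m + 1), {x : EuclideanSpace ℝ (Fin n) | f x = a i})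
    (R : ℝ) (hR : 0 < R)
    (hVR : {x : EuclideanSpace ℝ (Fin n) | f x ≤ a (Fin.last m)} ⊆ Metric.ball 0 R)
    (ftil : EuclideanSpace ℝ (Fin n) → ℝ) (hftiluc : UniformContinuous ftil)
    (A0til : ℝ) (hA0til : ∀ x, |ftil x| ≤ A0til)
    (hfeq : ∀ x : EuclideanSpace ℝ (Fin n), f x ≤ a (Fin.last m) → ftil x = f x)
    (hfout : ∀ x : EuclideanSpace ℝ (Fin n), R ≤ ‖x‖ → ftil x = a (Fin.last m) + 1)
    (ω : ℝ → ℝ) (hωconc : ConcaveOn ℝ (Set.Ici 0) ω) (hωmono : MonotoneOn ω (Set.Ici 0))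
    (hω0 : ω 0 = 0)
    (hωmod : ∀ x y : EuclideanSpace ℝ (Fin n), |ftil x - ftil y| ≤ ω (dist x y))
    (atil btil : ℝ) (hatil : 0 ≤ atil) (hbtil : 0 ≤ btil)
    (hωlin : ∀ t : ℝ, 0 ≤ t → ω t ≤ atil * t + btil)
    (lam M : ℝ) (hlam : a (Fin.last m) - a 0 + 1 < lam)
    (hM : A0til + lam * (2 * R + 1) ^ 2 < M) :
    ∀ i : Fin m, ∀ x ∈ {y : EuclideanSpace ℝ (Fin n) | a i.castSucc < f y ∧ f y < a i.succ},
      |avgApprox lam M f K x - f x| ≤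
        ω (gapWidth {y : EuclideanSpace ℝ (Fin n) | a i.castSucc < f y ∧ f y < a i.succ} x +
            atil / lam + Real.sqrt (2 * btil / lam)) := by
  intro i x hx
  set Q : Set (EuclideanSpace ℝ (Fin n)) := {y | a i.castSucc < f y ∧ f y < a i.succ}
  set b := a (Fin.last m)
  have hib : a i.succ ≤ b := ha.monotone (Fin.le_last _)
  have hlevel : ∀ j, {y | f y = a j} ⊆ K := fun j y hy => by
    rw [hK]
    exact mem_iUnion.2 ⟨j, hy⟩
  have hQR : Q ⊆ ball 0 R := fun y hy => hVR (hy.2.le.trans hib)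
  have hxb : f x < b := hx.2.trans_le hib
  have hlam0 : 0 < lam := by
    have := ha.monotone (Fin.zero_le (Fin.last m))
    linarith
  have hnt : Nontrivial (EuclideanSpace ℝ (Fin n)) := by
    obtain ⟨y, hy⟩ := hVne 0
    refine ⟨x, y, ?_⟩
    rintro rfl
    exact absurd (hx.1.trans_le hy) (ha.monotone (Fin.zero_le _)).not_gt
  have hQopen : IsOpen Q := isOpen_Ioo.preimage hf
  obtain ⟨r, hr, hrQ⟩ := Metric.nhds_basis_closedBall.mem_iff.1 (hQopen.mem_nhds hx)
  have hwidth : {d : ℝ | ∃ ν : EuclideanSpace ℝ (Fin n), ‖ν‖ = 1 ∧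
      d = dPlus Q x ν + dMinus Q x ν}.Nonempty := by
    obtain ⟨ν, hν⟩ := exists_norm_eq (EuclideanSpace ℝ (Fin n)) zero_le_one
    exact ⟨_, ν, hν, rfl⟩
  set D := gapWidth Q x
  have hDpos : 0 < D := by
    refine (add_pos hr hr).trans_le (le_csInf hwidth ?_)
    rintro _ ⟨ν, hν, rfl⟩
    rw [dMinus_eq_dPlus_neg]
    exact add_le_add (le_dPlus hQR hν hr hrQ) (le_dPlus hQR (by rwa [norm_neg]) hr hrQ)
  obtain ⟨_, ⟨ν, hν, rfl⟩, hνD⟩ := exists_lt_of_csInf_lt hwidth (show D < 2 * D by linarith)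
  rw [dMinus_eq_dPlus_neg] at hνD
  have hν' : ‖-ν‖ = 1 := by rwa [norm_neg]
  have hs := hr.trans_le (le_dPlus hQR hν hr hrQ)
  have ht := hr.trans_le (le_dPlus hQR hν' hr hrQ)
  have hsK : x + dPlus Q x ν • ν ∈ K :=
    (eq_or_eq_of_dPlus hf hQR hx hν hs).elim (fun h => hlevel _ h) (fun h => hlevel _ h)
  have htK : x + dPlus Q x (-ν) • (-ν) ∈ K :=
    (eq_or_eq_of_dPlus hf hQR hx hν' ht).elim (fun h => hlevel _ h) (fun h => hlevel _ h)
  set s := dPlus Q x ν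
  set t := dPlus Q x (-ν)
  have hst : 0 ≤ s * t := by positivity
  have hr₀ : √(s * t) < D := by
    rw [Real.sqrt_lt' hDpos]
    nlinarith [sq_nonneg (s - t)]
  have hfx : ftil x = f x := hfeq x hxb.le
  have key : ∀ h : EuclideanSpace ℝ (Fin n) → ℝ, (∀ y, |h y| ≤ A0til) →
      (∀ y, |h y - h x| ≤ ω ‖y - x‖) →
      2 * h x - 2 * ω (D + atil / lam + √(2 * btil / lam)) ≤
        lowerTransform lam (extendBy h K M) x - lowerTransform lam (extendBy (-h) K M) x := by
    intro h hh hmod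
    obtain ⟨η₀, h₀⟩ := mem_convexHull_liftedGraph_of_segment (h := h) (x := x) hν hs.le ht.le
      (add_pos hs ht) hsK htK
    rw [sub_self, norm_zero, zero_pow two_ne_zero, zero_add] at h₀
    have hgap : 0 < lam * (D ^ 2 - √(s * t) ^ 2) :=
      mul_pos hlam0 (sub_pos.2 (pow_lt_pow_left₀ hr₀ (Real.sqrt_nonneg _) two_ne_zero))
    refine le_of_forall_pos_le_add fun ε hε => ?_
    obtain ⟨q, hq, hqle, hge⟩ := exists_lowerTransform_sub_ge hlam0.le hh (sq_nonneg (2 * R))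
      (M := M) (by nlinarith) hωconc hωmono hmod
      (exists_dilation_mem_convexHull_liftedGraph hf hVR (hlevel _) hxb hν h) h₀
      (lt_min hε hgap)
    have hqT : √q ≤ D + atil / lam + √(2 * btil / lam) := by
      refine le_add_div_add_sqrt hlam0 hatil hbtil hDpos ?_ hr₀.le
      have h1 := hωlin _ (Real.sqrt_nonneg q)
      have h2 := hωlin _ (Real.sqrt_nonneg (s * t))
      have h3 := min_le_right ε (lam * (D ^ 2 - √(s * t) ^ 2))
      rw [Real.sq_sqrt hst] at h3 hqle ⊢
      rw [Real.sq_sqrt hq]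
      linarith
    have hωT := hωmono (Real.sqrt_nonneg q) ((Real.sqrt_nonneg q).trans hqT) hqT
    linarith [min_le_left ε (lam * (D ^ 2 - √(s * t) ^ 2))]
  have hext : extendBy f K M = extendBy ftil K M ∧ extendBy (-f) K M = extendBy (-ftil) K M := by
    have hKeq : ∀ y ∈ K, f y = ftil y := by
      intro y hy
      rw [hK] at hy
      obtain ⟨j, hj⟩ := mem_iUnion.1 hy
      exact (hfeq y (hj.le.trans (ha.monotone (Fin.le_last j)))).symm
    constructor <;> ext y <;> by_cases hy : y ∈ K <;> simp [extendBy, hy, hKeq]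
  have hmod : ∀ y, |ftil y - ftil x| ≤ ω ‖y - x‖ := fun y => by
    simpa [dist_eq_norm] using hωmod y x
  have h1 := key ftil hA0til hmod
  have h2 := key (-ftil) (fun y => by simpa using hA0til y) fun y => by
    simpa [neg_add_eq_sub, abs_sub_comm] using hmod y
  rw [neg_neg, Pi.neg_apply] at h2
  rw [avgApprox_eq, hext.1, hext.2, ← hfx, abs_le]
  constructor <;> linarith
end

section
/- Inpainting error estimate (C^{1,1} case) and interpolation: Let Λ ⊂ ℝ^n be convex and compact, Ω ⊂ Λ a nonempty open set, and K = Λ ∖ Ω. Let f : Λ → ℝ be bounded and uniformly continuous, and let f̃ : ℝ^n → ℝ be a differentiable extension of f whose gradient satisfies |Df̃(x) − Df̃(y)| ≤ L|x−y| for all x, y ∈ ℝ^n and some L > 0, with |f̃(x)| ≤ A_0 for all x ∈ ℝ^n, and f̃ = c_0 (a constant) outside the open ball B(0, r), where r > 0 and K ⊂ B(0, r). For R > r set K_R = K ∪ (ℝ^n ∖ B(0, R)). Then for every λ > L, every M > A_0 + λ(R + r)², and every x ∈ co[K]: |A^M_λ(f̃_{K_R})(x) − f̃(x)| ≤ (L/4)·(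 (λ + L/2)/(λ − L/2) + 1 )·r_c(x)², where r_c(x) is the convex density radius of x with respect to K; moreover A^M_λ(f̃_{K_R})(x) = f̃(x) for every x ∈ K. -/
open Metric Set

variable {E : Type*}

/-- Convex density radius `r_c(x)` of a point `x` with respect to a set `K`. -/
noncomputable def convexDensityRadius [NormedAddCommGroup E] [NormedSpace ℝ E]
    (K : Set E) (x : E) : ℝ :=
  sInf {r : ℝ | 0 ≤ r ∧ x ∈ convexHull ℝ (Metric.closedBall x r ∩ K)}

/-- Quadratic Taylor estimate for a function with Lipschitz derivative. -/
theorem sub_taylor_le_of_fderiv_lipschitz [NormedAddCommGroup E] [NormedSpace ℝ E] {f : E → ℝ}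
    {L : ℝ} (hf : Differentiable ℝ f)
    (hL : ∀ x y, ‖fderiv ℝ f x - fderiv ℝ f y‖ ≤ L * ‖x - y‖) (x y : E) :
    f y - f x - fderiv ℝ f x (y - x) ≤ L / 2 * ‖y - x‖ ^ 2 := by
  set v := y - x with hv
  have hder : ∀ t : ℝ, HasDerivAt
      (fun t : ℝ => f (x + t • v) - t * fderiv ℝ f x v - L / 2 * ‖v‖ ^ 2 * t ^ 2)
      (fderiv ℝ f (x + t • v) v - fderiv ℝ f x v - L * ‖v‖ ^ 2 * t) t := by
    intro t
    have hline : HasDerivAt (fun t : ℝ => x + t • v) v t := by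
      simpa using ((hasDerivAt_id t).smul_const v).const_add x
    have hcomp : HasDerivAt (fun t : ℝ => f (x + t • v)) (fderiv ℝ f (x + t • v) v) t :=
      (hf (x + t • v)).hasFDerivAt.comp_hasDerivAt t hline
    refine ((hcomp.fun_sub ((hasDerivAt_id' t).mul_const (fderiv ℝ f x v))).fun_sub
      ((hasDerivAt_pow 2 t).const_mul (L / 2 * ‖v‖ ^ 2))).congr_deriv ?_
    push_cast
    ring
  have hanti : AntitoneOn
      (fun t : ℝ => f (x + t • v) - t * fderiv ℝ f x v - L / 2 * ‖v‖ ^ 2 * t ^ 2) (Icc 0 1) := by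
    refine antitoneOn_of_deriv_nonpos (convex_Icc 0 1)
      (fun t _ => (hder t).continuousAt.continuousWithinAt)
      (fun t _ => (hder t).differentiableAt.differentiableWithinAt) fun t ht => ?_
    rw [interior_Icc] at ht
    rw [(hder t).deriv]
    have hop : fderiv ℝ f (x + t • v) v - fderiv ℝ f x v ≤ L * ‖v‖ ^ 2 * t := calc
      _ = (fderiv ℝ f (x + t • v) - fderiv ℝ f x) v := rfl
      _ ≤ ‖(fderiv ℝ f (x + t • v) - fderiv ℝ f x) v‖ := le_abs_self _
      _ ≤ ‖fderiv ℝ f (x + t • v) - fderiv ℝ f x‖ * ‖v‖ := ContinuousLinearMap.le_opNorm _ _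
      _ ≤ L * ‖x + t • v - x‖ * ‖v‖ := by gcongr; exact hL _ _
      _ = L * ‖v‖ ^ 2 * t := by
        rw [add_sub_cancel_left, norm_smul, Real.norm_of_nonneg ht.1.le]; ring
    linarith
  have h01 := hanti (left_mem_Icc.2 zero_le_one) (right_mem_Icc.2 zero_le_one) zero_le_one
  have hxv : x + v = y := by rw [hv]; abel
  simp only [one_smul, zero_smul, add_zero, hxv] at h01
  linarith

theorem abs_sub_taylor_le_of_fderiv_lipschitz [NormedAddCommGroup E] [NormedSpace ℝ E] {f : E → ℝ}
    {L : ℝ} (hf : Differentiable ℝ f)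
    (hL : ∀ x y, ‖fderiv ℝ f x - fderiv ℝ f y‖ ≤ L * ‖x - y‖) (x y : E) :
    |f y - f x - fderiv ℝ f x (y - x)| ≤ L / 2 * ‖y - x‖ ^ 2 := by
  refine abs_le.2 ⟨?_, sub_taylor_le_of_fderiv_lipschitz hf hL x y⟩
  have hneg := sub_taylor_le_of_fderiv_lipschitz (f := fun z => -f z) (L := L) hf.fun_neg
    (fun a b => by
      simp only [fderiv_fun_neg]
      rw [← neg_sub', norm_neg]
      exact hL a b) x y
  simp only [fderiv_fun_neg, neg_apply] at hneg
  linarith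

/-- The affine first-order expansion at `x` of the function `lam * ‖·‖ ^ 2 + f`. -/
noncomputable def affineExpansion [NormedAddCommGroup E] [InnerProductSpace ℝ E]
    (lam : ℝ) (f : E → ℝ) (x : E) : E →ᵃ[ℝ] ℝ :=
  ((2 * lam) • (innerSL ℝ x : E →ₗ[ℝ] ℝ) + (fderiv ℝ f x : E →ₗ[ℝ] ℝ)).toAffineMap +
    AffineMap.const ℝ E (f x - lam * ‖x‖ ^ 2 - fderiv ℝ f x x)

theorem affineExpansion_apply [NormedAddCommGroup E] [InnerProductSpace ℝ E]
    (lam : ℝ) (f : E → ℝ) (x y : E) :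
    affineExpansion lam f x y =
      lam * ‖y‖ ^ 2 - lam * ‖y - x‖ ^ 2 + (f x + fderiv ℝ f x (y - x)) := by
  simp only [affineExpansion, AffineMap.coe_add, Pi.add_apply, LinearMap.coe_toAffineMap,
    AffineMap.const_apply, LinearMap.add_apply, LinearMap.smul_apply, ContinuousLinearMap.coe_coe,
    innerSL_apply_apply, smul_eq_mul, map_sub]
  rw [norm_sub_sq_real, real_inner_comm]
  ring

theorem affineExpansion_self [NormedAddCommGroup E] [InnerProductSpace ℝ E]
    (lam : ℝ) (f : E → ℝ) (x : E) : affineExpansion lam f x x = lam * ‖x‖ ^ 2 + f x := by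
  simp [affineExpansion_apply]

theorem le_convEnv [NormedAddCommGroup E] [NormedSpace ℝ E] {g : E → ℝ} {l : E →ᵃ[ℝ] ℝ}
    (hl : ∀ y, l y ≤ g y) (x : E) : l x ≤ convEnv g x :=
  le_csSup ⟨g x, by rintro _ ⟨m, hm, rfl⟩; exact hm x⟩ ⟨l, hl, rfl⟩

/-- The convex envelope of a function bounded below is controlled by its affine minorants. -/
theorem convEnv_le [NormedAddCommGroup E] [NormedSpace ℝ E] {g : E → ℝ} {x : E} {c b : ℝ}
    (hg : ∀ y, c ≤ g y) (h : ∀ l : E →ᵃ[ℝ] ℝ, (∀ y, l y ≤ g y) → l x ≤ b) : convEnv g x ≤ b :=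
  csSup_le ⟨_, AffineMap.const ℝ E c, by simpa using hg, rfl⟩ (by rintro _ ⟨l, hl, rfl⟩; exact h l hl)

theorem AffineMap.le_of_mem_convexHull [AddCommGroup E] [Module ℝ E] {l : E →ᵃ[ℝ] ℝ} {s : Set E}
    {c : ℝ} (h : ∀ y ∈ s, l y ≤ c) {x : E} (hx : x ∈ convexHull ℝ s) : l x ≤ c :=
  convexHull_min (t := l ⁻¹' Iic c) h ((convex_Iic c).affine_preimage l) hx

theorem extendBy_neg (f : E → ℝ) (S : Set E) (M : ℝ) (x : E) :
    extendBy (fun z => -f z) S M x = -extendBy f S (-M) x := by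
  unfold extendBy
  split_ifs <;> simp

theorem neg_bound_le_quadratic_add_extendBy [NormedAddCommGroup E] {f : E → ℝ} {S : Set E}
    {lam M A0 : ℝ} (hlam : 0 ≤ lam) (hA0 : ∀ x, |f x| ≤ A0) (hM : A0 ≤ M) (y : E) :
    -A0 ≤ lam * ‖y‖ ^ 2 + extendBy f S M y := by
  have hq : 0 ≤ lam * ‖y‖ ^ 2 := by positivity
  have hf := abs_le.1 (hA0 y)
  unfold extendBy
  split_ifs <;> linarith

section

variable [NormedAddCommGroup E] [InnerProductSpace ℝ E] {f : E → ℝ} {lam L : ℝ}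

/-- On the sample set, an affine minorant exceeds the first-order expansion at most
quadratically. -/
theorem minorant_sub_affineExpansion_le (hf : Differentiable ℝ f)
    (hL : ∀ x y, ‖fderiv ℝ f x - fderiv ℝ f y‖ ≤ L * ‖x - y‖) {S : Set E} {M : ℝ}
    {l : E →ᵃ[ℝ] ℝ} (hl : ∀ y, l y ≤ lam * ‖y‖ ^ 2 + extendBy f S M y) (x : E) {y : E}
    (hy : y ∈ S) : (l - affineExpansion lam f x) y ≤ (lam + L / 2) * ‖y - x‖ ^ 2 := by
  have hly := hl y
  rw [extendBy, if_pos hy] at hly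
  have htay := (abs_le.1 (abs_sub_taylor_le_of_fderiv_lipschitz hf hL x y)).2
  rw [AffineMap.coe_sub, Pi.sub_apply, affineExpansion_apply]
  linarith

/-- The lower transform exceeds the function by at most a multiple of the squared radius of any
ball whose sample points surround `x`. -/
theorem convEnv_sub_le_radius_sq (hf : Differentiable ℝ f)
    (hL : ∀ x y, ‖fderiv ℝ f x - fderiv ℝ f y‖ ≤ L * ‖x - y‖) (hLlam : 0 ≤ lam + L / 2)
    (hlam : 0 ≤ lam) {A0 M : ℝ} (hA0 : ∀ x, |f x| ≤ A0) (hM : A0 ≤ M) {S : Set E} {x : E} {ρ : ℝ}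
    (hx : x ∈ convexHull ℝ (closedBall x ρ ∩ S)) :
    convEnv (fun y => lam * ‖y‖ ^ 2 + extendBy f S M y) x - lam * ‖x‖ ^ 2 - f x ≤
      (lam + L / 2) * ρ ^ 2 := by
  rw [sub_sub, sub_le_iff_le_add]
  refine convEnv_le (neg_bound_le_quadratic_add_extendBy hlam hA0 hM) fun l hl => ?_
  have hmax := AffineMap.le_of_mem_convexHull (l := l - affineExpansion lam f x)
    (c := (lam + L / 2) * ρ ^ 2) (fun y hy => ?_) hx
  · rw [AffineMap.coe_sub, Pi.sub_apply, affineExpansion_self] at hmax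
    linarith
  · refine (minorant_sub_affineExpansion_le hf hL hl x hy.2).trans ?_
    have hdist : ‖y - x‖ ≤ ρ := mem_closedBall_iff_norm.1 hy.1
    gcongr

/-- The excess of the transform of `f` is comparable with the excess of the transform of `-f`. -/
theorem mul_convEnv_sub_le_convEnv_neg [Nontrivial E] (hf : Differentiable ℝ f)
    (hL : ∀ x y, ‖fderiv ℝ f x - fderiv ℝ f y‖ ≤ L * ‖x - y‖) (hL0 : 0 < L) (hLlam : L < lam)
    {A0 M r R : ℝ} (hA0 : ∀ x, |f x| ≤ A0) (hr : 0 < r) (hR : r < R)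
    (hM : A0 + lam * (R + r) ^ 2 < M) (K : Set E) {x : E} (hx : ‖x‖ ≤ r) :
    (lam - L / 2) / (lam + L / 2) *
        (convEnv (fun y => lam * ‖y‖ ^ 2 + extendBy f (K ∪ (ball 0 R)ᶜ) M y) x
          - lam * ‖x‖ ^ 2 - f x) ≤
      convEnv (fun y => lam * ‖y‖ ^ 2 - extendBy f (K ∪ (ball 0 R)ᶜ) (-M) y) x
        - lam * ‖x‖ ^ 2 + f x := by
  set S := K ∪ (ball (0 : E) R)ᶜ with hS
  set g := fun y => lam * ‖y‖ ^ 2 - extendBy f S (-M) y with hg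
  have hlam : 0 < lam := hL0.trans hLlam
  have hnum : 0 < lam - L / 2 := by linarith
  have hden : 0 < lam + L / 2 := by linarith
  set θ := (lam - L / 2) / (lam + L / 2) with hθ
  have hθ0 : 0 < θ := div_pos hnum hden
  have hθmul : θ * (lam + L / 2) = lam - L / 2 := div_mul_cancel₀ _ hden.ne'
  have hRr : 0 ≤ lam * (R + r) ^ 2 := by positivity
  rw [← le_div_iff₀' hθ0, sub_sub, sub_le_iff_le_add]
  refine convEnv_le (neg_bound_le_quadratic_add_extendBy hlam.le hA0 (by linarith)) fun l hl => ?_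
  set d := l - affineExpansion lam f x with hd
  have hdS : ∀ y ∈ S, d y ≤ (lam + L / 2) * ‖y - x‖ ^ 2 := fun y hy =>
    minorant_sub_affineExpansion_le hf hL hl x hy
  have hneg : ∀ y, affineExpansion lam (fun z => -f z) x y =
      lam * ‖y‖ ^ 2 - lam * ‖y - x‖ ^ 2 - (f x + fderiv ℝ f x (y - x)) := fun y => by
    rw [affineExpansion_apply, fderiv_fun_neg, neg_apply]; ring
  have hm : ∀ y, (θ • d + affineExpansion lam (fun z => -f z) x) y ≤ g y := by
    intro y
    have htay := abs_le.1 (abs_sub_taylor_le_of_fderiv_lipschitz hf hL x y)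
    rw [AffineMap.coe_add, Pi.add_apply, AffineMap.coe_smul, Pi.smul_apply, smul_eq_mul, hneg]
    by_cases hy : y ∈ S
    · have hdy := mul_le_mul_of_nonneg_left (hdS y hy) hθ0.le
      rw [← mul_assoc, hθmul] at hdy
      simp only [hg, extendBy, if_pos hy]
      linarith
    · have hyR : ‖y‖ < R := by_contra fun h => hy (Or.inr (by simpa using h))
      have hdy : d y ≤ (lam + L / 2) * (R + r) ^ 2 := by
        refine AffineMap.le_of_mem_convexHull (s := sphere 0 R) (fun z hz => ?_) ?_
        · have hzR : ‖z‖ = R := by simpa using hz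
          refine (hdS z (Or.inr ?_)).trans ?_
          · simp [hzR]
          · have := norm_sub_le z x
            gcongr
            linarith
        · rw [convexHull_sphere_eq_closedBall 0 (hr.trans hR).le]
          simpa using hyR.le
      have hdy' := mul_le_mul_of_nonneg_left hdy hθ0.le
      rw [← mul_assoc, hθmul] at hdy'
      have hfy := abs_le.1 (hA0 y)
      have hq : 0 ≤ (lam - L / 2) * ‖y - x‖ ^ 2 := by positivity
      have hq' : 0 ≤ L / 2 * (R + r) ^ 2 := by positivity
      simp only [hg, extendBy, if_neg hy]
      linarith
  have hmx := le_convEnv hm x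
  rw [AffineMap.coe_add, Pi.add_apply, AffineMap.coe_smul, Pi.smul_apply, smul_eq_mul,
    affineExpansion_self, hd, AffineMap.coe_sub, Pi.sub_apply, affineExpansion_self] at hmx
  rw [← sub_le_iff_le_add, le_div_iff₀' hθ0]
  linarith

/-- One-sided comparison of the errors of the lower and upper transforms. -/
theorem convEnv_sub_convEnv_neg_le [Nontrivial E] (hf : Differentiable ℝ f)
    (hL : ∀ x y, ‖fderiv ℝ f x - fderiv ℝ f y‖ ≤ L * ‖x - y‖) (hL0 : 0 < L) (hLlam : L < lam)
    {A0 M r R : ℝ} (hA0 : ∀ x, |f x| ≤ A0) (hr : 0 < r) (hR : r < R)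
    (hM : A0 + lam * (R + r) ^ 2 < M) {K : Set E} {x : E} (hx : ‖x‖ ≤ r) {ρ : ℝ}
    (hρ : x ∈ convexHull ℝ (closedBall x ρ ∩ K)) :
    convEnv (fun y => lam * ‖y‖ ^ 2 + extendBy f (K ∪ (ball 0 R)ᶜ) M y) x
        - convEnv (fun y => lam * ‖y‖ ^ 2 - extendBy f (K ∪ (ball 0 R)ᶜ) (-M) y) x - 2 * f x ≤
      L * ρ ^ 2 := by
  have hlam : 0 < lam := hL0.trans hLlam
  have hden : 0 < lam + L / 2 := by linarith
  have hRr : 0 ≤ lam * (R + r) ^ 2 := by positivity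
  have hcomp := mul_convEnv_sub_le_convEnv_neg hf hL hL0 hLlam hA0 hr hR hM K hx
  have hrad := convEnv_sub_le_radius_sq (M := M) (S := K ∪ (ball 0 R)ᶜ) hf hL hden.le hlam.le hA0
    (by linarith)
    (convexHull_mono (inter_subset_inter_right _ subset_union_left) hρ)
  set a := convEnv (fun y => lam * ‖y‖ ^ 2 + extendBy f (K ∪ (ball 0 R)ᶜ) M y) x
    - lam * ‖x‖ ^ 2 - f x with ha
  have hgap : a - (lam - L / 2) / (lam + L / 2) * a ≤ L * ρ ^ 2 := calc
    _ = L / (lam + L / 2) * a := by field_simp; ring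
    _ ≤ L / (lam + L / 2) * ((lam + L / 2) * ρ ^ 2) := by gcongr
    _ = L * ρ ^ 2 := by field_simp
  linarith

/-- Error of the average approximation in terms of any radius whose ball contains sample points
surrounding `x`. -/
theorem abs_avgApprox_sub_le [Nontrivial E] (hf : Differentiable ℝ f)
    (hL : ∀ x y, ‖fderiv ℝ f x - fderiv ℝ f y‖ ≤ L * ‖x - y‖) (hL0 : 0 < L) (hLlam : L < lam)
    {A0 M r R : ℝ} (hA0 : ∀ x, |f x| ≤ A0) (hr : 0 < r) (hR : r < R)
    (hM : A0 + lam * (R + r) ^ 2 < M) {K : Set E} {x : E} (hx : ‖x‖ ≤ r) {ρ : ℝ}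
    (hρ : x ∈ convexHull ℝ (closedBall x ρ ∩ K)) :
    |avgApprox lam M f (K ∪ (ball 0 R)ᶜ) x - f x| ≤ L / 2 * ρ ^ 2 := by
  have hpos := convEnv_sub_convEnv_neg_le hf hL hL0 hLlam hA0 hr hR hM hx hρ
  have hneg := convEnv_sub_convEnv_neg_le (f := fun z => -f z) hf.fun_neg
    (fun a b => by
      simp only [fderiv_fun_neg]
      rw [← neg_sub', norm_neg]
      exact hL a b) hL0 hLlam (by simpa using hA0) hr hR hM hx hρ
  simp only [extendBy_neg, neg_neg, sub_neg_eq_add, ← sub_eq_add_neg] at hneg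
  unfold avgApprox lowerTransform upperTransform
  rw [abs_le]
  constructor <;> linarith

end

/-- **Inpainting error estimate (C^{1,1} case) and interpolation.** -/
theorem inpainting_error_estimate_C11 {n : ℕ}
    (Λ : Set (EuclideanSpace ℝ (Fin n))) (hΛconv : Convex ℝ Λ) (hΛcpt : IsCompact Λ)
    (Ω : Set (EuclideanSpace ℝ (Fin n))) (hΩsub : Ω ⊆ Λ) (hΩne : Ω.Nonempty)
    (hΩopen : IsOpen Ω)
    (K : Set (EuclideanSpace ℝ (Fin n))) (hK : K = Λ \ Ω)
    (f : EuclideanSpace ℝ (Fin n) → ℝ)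
    (hfbd : ∃ C : ℝ, ∀ x ∈ Λ, |f x| ≤ C) (hfuc : UniformContinuousOn f Λ)
    (ftil : EuclideanSpace ℝ (Fin n) → ℝ)
    (hext : ∀ x ∈ Λ, ftil x = f x)
    (hdiff : Differentiable ℝ ftil)
    (L : ℝ) (hL : 0 < L)
    (hDlip : ∀ x y : EuclideanSpace ℝ (Fin n),
      ‖fderiv ℝ ftil x - fderiv ℝ ftil y‖ ≤ L * ‖x - y‖)
    (A0 : ℝ) (hA0 : ∀ x, |ftil x| ≤ A0)
    (c0 r : ℝ) (hr : 0 < r)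
    (hc0 : ∀ x : EuclideanSpace ℝ (Fin n), r ≤ ‖x‖ → ftil x = c0)
    (hKr : K ⊆ Metric.ball 0 r)
    (R : ℝ) (hR : r < R)
    (lam M : ℝ) (hlam : L < lam) (hM : A0 + lam * (R + r) ^ 2 < M) :
    (∀ x ∈ convexHull ℝ K,
      |avgApprox lam M ftil (K ∪ (Metric.ball 0 R)ᶜ) x - ftil x| ≤
        L / 4 * ((lam + L / 2) / (lam - L / 2) + 1) * convexDensityRadius K x ^ 2) ∧
    (∀ x ∈ K, avgApprox lam M ftil (K ∪ (Metric.ball 0 R)ᶜ) x = ftil x) := by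
  have herr : ∀ x ∈ convexHull ℝ K, ∀ ρ : ℝ, x ∈ convexHull ℝ (closedBall x ρ ∩ K) →
      |avgApprox lam M ftil (K ∪ (ball 0 R)ᶜ) x - ftil x| ≤ L / 2 * ρ ^ 2 := by
    intro x hx ρ hρ
    obtain ⟨k, hk⟩ := convexHull_nonempty_iff.1 ⟨x, hx⟩
    obtain ⟨w, hw⟩ := hΩne
    have : Nontrivial (EuclideanSpace ℝ (Fin n)) :=
      ⟨k, w, by rintro rfl; rw [hK] at hk; exact hk.2 hw⟩
    have hxr : x ∈ ball (0 : EuclideanSpace ℝ (Fin n)) r :=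
      convexHull_min hKr (convex_ball 0 r) hx
    exact abs_avgApprox_sub_le hdiff hDlip hL hlam hA0 hr hR hM (mem_ball_zero_iff.1 hxr).le hρ
  constructor
  · intro x hx
    set D := |avgApprox lam M ftil (K ∪ (ball 0 R)ᶜ) x - ftil x| with hD
    have hxr : x ∈ ball (0 : EuclideanSpace ℝ (Fin n)) r :=
      convexHull_min hKr (convex_ball 0 r) hx
    have hsub : K ⊆ closedBall x (2 * r) := fun y hy => by
      have hyr := mem_ball_zero_iff.1 (hKr hy)
      rw [mem_ball_zero_iff] at hxr
      rw [mem_closedBall_iff_norm]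
      linarith [norm_sub_le y x]
    have hsqrt : √(2 * D / L) ≤ convexDensityRadius K x := by
      refine le_csInf ⟨2 * r, by positivity, by rwa [inter_eq_right.2 hsub]⟩ fun ρ hρ => ?_
      refine Real.sqrt_le_iff.2 ⟨hρ.1, ?_⟩
      rw [div_le_iff₀ hL]
      linarith [herr x hx ρ hρ.2]
    have hsq : D ≤ L / 2 * convexDensityRadius K x ^ 2 := by
      have h := (Real.sqrt_le_left ((Real.sqrt_nonneg _).trans hsqrt)).1 hsqrt
      rw [div_le_iff₀ hL] at h
      linarith
    have hratio : 1 ≤ (lam + L / 2) / (lam - L / 2) := by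
      rw [one_le_div (by linarith)]
      linarith
    refine hsq.trans ?_
    gcongr
    calc L / 2 = L / 4 * (1 + 1) := by ring
      _ ≤ _ := by gcongr
  · intro x hx
    have h := herr x (subset_convexHull ℝ K hx) 0
      (subset_convexHull ℝ _ ⟨mem_closedBall_self le_rfl, hx⟩)
    rw [← sub_eq_zero, ← abs_nonpos_iff]
    simpa using h
end
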